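/- Let m ≥ 4 be even, n ≥ 3 be odd, and let s be an integer whose multiplicative order modulo n equals 2. If gcd(m/2, n) = 1, then d(G_{m,n,s}) = mn/2 and E(G_{m,n,s}) ≥ 3mn/2; in particular it is not the case that both d(G_{m,n,s}) = m + n − 2 and E(G_{m,n,s}) = mn + m + n − 2. -/

import Mathlib

/-- A sequence (multiset) over a group is *product-one* if its terms can be
ordered so that their product is `1`. -/
def IsProductOne {G : Type*} [Group G] (S : Multiset G) : Prop :=
  ∃ l : List G, (l : Multiset G) = S ∧ l.prod = 1

/-- A sequence is *product-one free* if no nonempty subsequence is product-one. -/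
def ProductOneFree {G : Type*} [Group G] (S : Multiset G) : Prop :=
  ∀ T : Multiset G, T ≤ S → T ≠ 0 → ¬ IsProductOne T

/-- The small Davenport constant: maximal length of a product-one free sequence. -/
noncomputable def smallDavenport (G : Type*) [Group G] : ℕ :=
  sSup {k : ℕ | ∃ S : Multiset G, Multiset.card S = k ∧ ProductOneFree S}

/-- The Gao constant: the least `ℓ > 0` such that every sequence of length at least `ℓ`
contains a product-one subsequence of length `|G|`. -/
noncomputable def gaoConstant (G : Type*) [Group G] : ℕ :=
  sInf {ℓ : ℕ | 0 < ℓ ∧ ∀ S : Multiset G, ℓ ≤ Multiset.card S →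
    ∃ T : Multiset G, T ≤ S ∧ Multiset.card T = Nat.card G ∧ IsProductOne T}

/-- Relations of the metacyclic group `⟨x, y ∣ x^m = y^n = 1, y*x = x*y^s⟩`. -/
def metacyclicRels (m n : ℕ) (s : ℤ) : Set (FreeGroup (Fin 2)) :=
  {FreeGroup.of 0 ^ m, FreeGroup.of 1 ^ n,
    FreeGroup.of 1 * FreeGroup.of 0 * (FreeGroup.of 0 * FreeGroup.of 1 ^ s)⁻¹}

/-- The metacyclic group `G_{m,n,s} = Cₙ ⋊ₛ Cₘ = ⟨x, y ∣ x^m = y^n = 1, y*x = x*y^s⟩`. -/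
abbrev Metacyclic (m n : ℕ) (s : ℤ) : Type := PresentedGroup (metacyclicRels m n s)

/-- The generator `x` of `G_{m,n,s}`. -/
def mcX (m n : ℕ) (s : ℤ) : Metacyclic m n s := PresentedGroup.of 0

/-- The generator `y` of `G_{m,n,s}`. -/
def mcY (m n : ℕ) (s : ℤ) : Metacyclic m n s := PresentedGroup.of 1


section Abstract
variable {G : Type*} [Group G]

def Reach (S : Multiset G) (g : G) : Prop := ∃ l : List G, (l : Multiset G) ≤ S ∧ l.prod = g

def Good (K : Subgroup G) (S : Multiset G) (k : ℕ) : Prop :=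
  ∃ X : Finset G, 1 ∈ X ∧ (∀ x ∈ X, x ∈ K ∧ Reach S x) ∧ k ≤ X.card

lemma free_of_le {S T : Multiset G} (h : S ≤ T) (hT : ProductOneFree T) : ProductOneFree S :=
  fun U hU => hT U (hU.trans h)

lemma reach_mul {S : Multiset G} {la : List G} {x : G} (h : Reach S x) :
    Reach ((la : Multiset G) + S) (x * la.prod) := by
  obtain ⟨l, hl, rfl⟩ := h
  refine ⟨l ++ la, ?_, by simp⟩
  rw [← Multiset.coe_add, add_comm]
  exact add_le_add_right hl _

lemma reach_mono {S T : Multiset G} (hST : S ≤ T) {x : G} (h : Reach S x) : Reach T x := by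
  obtain ⟨l, hl, rfl⟩ := h
  exact ⟨l, hl.trans hST, rfl⟩

lemma not_reach_inv {S : Multiset G} {la : List G} (hla : la ≠ [])
    (hf : ProductOneFree ((la : Multiset G) + S)) : ¬ Reach S la.prod⁻¹ := by
  rintro ⟨l, hl, hp⟩
  refine hf ((l ++ la : List G) : Multiset G) ?_ (by simpa using fun _ => hla) ⟨l ++ la, rfl, by simp [hp]⟩
  rw [← Multiset.coe_add, add_comm]
  exact add_le_add_right hl _

lemma good_zero (K : Subgroup G) : Good K 0 1 :=
  ⟨{1}, by simp, by
    intro x hx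
    rw [Finset.mem_singleton.1 hx]
    exact ⟨K.one_mem, [], by simp, rfl⟩, by simp⟩

lemma Good.mono {K : Subgroup G} {S : Multiset G} {k j : ℕ} (h : Good K S k) (hj : j ≤ k) :
    Good K S j := by
  obtain ⟨X, a, b, c⟩ := h
  exact ⟨X, a, b, hj.trans c⟩

lemma Good.le_card {K : Subgroup G} [Finite G] {S : Multiset G} {k : ℕ} (h : Good K S k) :
    k ≤ Nat.card K := by
  obtain ⟨X, a, b, c⟩ := h
  refine c.trans ?_
  have : (X : Set G).ncard ≤ (K : Set G).ncard :=
    Set.ncard_le_ncard (fun x hx => (b x hx).1) (Set.toFinite _)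
  rw [Set.ncard_coe_finset] at this
  exact this

open Classical in
lemma grow1 {K : Subgroup G} {S : Multiset G} {k : ℕ} (h : Good K S k) {la : List G}
    (hla : la ≠ []) (hu : la.prod ∈ K) (hf : ProductOneFree ((la : Multiset G) + S)) :
    Good K ((la : Multiset G) + S) (k + 1) := by
  obtain ⟨X, h1, hX, hk⟩ := h
  set u := la.prod with hudef
  have hnu : u⁻¹ ∉ X := fun hh => not_reach_inv hla hf (hX _ hh).2
  refine ⟨X ∪ X.image (· * u), by simp [h1], ?_, ?_⟩
  · intro x hx
    rw [Finset.mem_union, Finset.mem_image] at hx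
    rcases hx with hx | ⟨y, hy, rfl⟩
    · exact ⟨(hX x hx).1, reach_mono (by simp) (hX x hx).2⟩
    · exact ⟨K.mul_mem (hX y hy).1 hu, reach_mul (hX y hy).2⟩
  · by_contra hlt
    have hc : (X.image (· * u)).card = X.card :=
      Finset.card_image_of_injective _ (mul_left_injective u)
    have hsub : X ⊆ X ∪ X.image (· * u) := Finset.subset_union_left
    have e1 : X = X ∪ X.image (· * u) := Finset.eq_of_subset_of_card_le hsub (by omega)
    have e2 : X.image (· * u) = X :=
      Finset.eq_of_subset_of_card_le (Finset.union_eq_left.1 e1.symm) (by omega)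
    rw [← e2, Finset.mem_image] at h1
    obtain ⟨x, hx, hxu⟩ := h1
    exact hnu (by rwa [← eq_inv_of_mul_eq_one_left hxu])

open Classical in
lemma grow2 {K : Subgroup G} (hK : ∀ a ∈ K, ∀ b ∈ K, a * b = b * a)
    {S : Multiset G} {k : ℕ} (h : Good K S k) {p q : G}
    (hu : p * q ∈ K) (hv : q * p ∈ K) (hne : p * q ≠ q * p)
    (hf : ProductOneFree (p ::ₘ q ::ₘ S)) :
    Good K (p ::ₘ q ::ₘ S) (k + 2) := by
  obtain ⟨X, h1, hX, hk⟩ := h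
  have E1 : (([p, q] : List G) : Multiset G) + S = p ::ₘ q ::ₘ S := by
    simp [← Multiset.cons_coe]
  have E2 : (([q, p] : List G) : Multiset G) + S = p ::ₘ q ::ₘ S := by
    simp [← Multiset.cons_coe]; exact Multiset.cons_swap _ _ _
  set u := p * q with hudef
  set v := q * p with hvdef
  have hnu : u⁻¹ ∉ X := fun hh => not_reach_inv (la := [p, q]) (by simp) (by rwa [E1])
    (by simpa [hudef, hvdef] using (hX _ hh).2)
  have hnv : v⁻¹ ∉ X := fun hh => not_reach_inv (la := [q, p]) (by simp) (by rwa [E2])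
    (by simpa [hudef, hvdef] using (hX _ hh).2)
  set Z := X ∪ (X.image (· * u) ∪ X.image (· * v)) with hZ
  refine ⟨Z, by simp [hZ, h1], ?_, ?_⟩
  · intro x hx
    rw [hZ, Finset.mem_union, Finset.mem_union, Finset.mem_image, Finset.mem_image] at hx
    rcases hx with hx | ⟨y, hy, rfl⟩ | ⟨y, hy, rfl⟩
    · exact ⟨(hX x hx).1, reach_mono ((Multiset.le_cons_self _ _).trans (Multiset.le_cons_self _ _)) (hX x hx).2⟩
    · refine ⟨K.mul_mem (hX y hy).1 hu, ?_⟩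
      have := reach_mul (la := [p, q]) (hX y hy).2
      rw [E1] at this
      simpa using this
    · refine ⟨K.mul_mem (hX y hy).1 hv, ?_⟩
      have := reach_mul (la := [q, p]) (hX y hy).2
      rw [E2] at this
      simpa using this
  · by_contra hlt
    have hcu : (X.image (· * u)).card = X.card :=
      Finset.card_image_of_injective _ (mul_left_injective u)
    have hcv : (X.image (· * v)).card = X.card :=
      Finset.card_image_of_injective _ (mul_left_injective v)
    have h1Z : 1 ∈ Z := by simp [hZ, h1]
    have hce := Finset.card_erase_of_mem h1Z
    have n1u : 1 ∉ X.image (· * u) := by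
      rw [Finset.mem_image]
      rintro ⟨x, hx, hxu⟩
      exact hnu (by rwa [← eq_inv_of_mul_eq_one_left hxu])
    have n1v : 1 ∉ X.image (· * v) := by
      rw [Finset.mem_image]
      rintro ⟨x, hx, hxu⟩
      exact hnv (by rwa [← eq_inv_of_mul_eq_one_left hxu])
    have su : X.image (· * u) ⊆ Z :=
      Finset.subset_union_left.trans Finset.subset_union_right
    have sv : X.image (· * v) ⊆ Z :=
      Finset.subset_union_right.trans Finset.subset_union_right
    have eu : X.image (· * u) = Z.erase 1 :=
      Finset.eq_of_subset_of_card_le (Finset.subset_erase.2 ⟨su, n1u⟩) (by omega)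
    have ev : X.image (· * v) = Z.erase 1 :=
      Finset.eq_of_subset_of_card_le (Finset.subset_erase.2 ⟨sv, n1v⟩) (by omega)
    have m1 : u ∈ X.image (· * v) := by
      rw [ev, ← eu]; exact Finset.mem_image.2 ⟨1, h1, one_mul _⟩
    obtain ⟨x, hx, hxu⟩ := Finset.mem_image.1 m1
    have hx1 : x ≠ 1 := by
      rintro rfl
      exact hne (by rw [← hxu, one_mul])
    have m2 : x ∈ X.image (· * u) := by
      rw [eu]; exact Finset.mem_erase.2 ⟨hx1, Finset.mem_union_left _ hx⟩
    obtain ⟨y, hy, hyu⟩ := Finset.mem_image.1 m2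
    have : y * v = 1 := by
      have h3 : (y * v) * u = u := by
        rw [mul_assoc, hK v hv u hu, ← mul_assoc, hyu, hxu]
      exact mul_eq_right.1 h3
    exact hnv (by rwa [← eq_inv_of_mul_eq_one_left this])

lemma grow_list {K : Subgroup G} {S : Multiset G} {k : ℕ} (h : Good K S k) (A : Multiset G)
    (hA : ∀ a ∈ A, a ∈ K) (hf : ProductOneFree (A + S)) : Good K (A + S) (k + A.card) := by
  induction A using Multiset.induction with
  | empty => simpa using h
  | cons a A ih =>
    have := ih (fun b hb => hA b (Multiset.mem_cons_of_mem hb))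
      (free_of_le (by simp [Multiset.cons_add, Multiset.le_cons_self]) hf)
    have h2 := grow1 this (la := [a]) (by simp) (by simpa using hA a (by simp))
      (by simpa using hf)
    simpa [add_assoc] using h2

def flat (L : Multiset (G × G)) : Multiset G := L.map Prod.fst + L.map Prod.snd

lemma flat_cons (p : G × G) (L : Multiset (G × G)) :
    flat (p ::ₘ L) = p.1 ::ₘ p.2 ::ₘ flat L := by
  simp [flat]
  exact Multiset.cons_swap _ _ _

lemma card_flat (L : Multiset (G × G)) : (flat L).card = 2 * L.card := by
  simp [flat]; omega

lemma grow_pairs {K : Subgroup G} (hK : ∀ a ∈ K, ∀ b ∈ K, a * b = b * a)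
    {S : Multiset G} {k : ℕ} (h : Good K S k) (L : Multiset (G × G))
    (hL : ∀ p ∈ L, p.1 * p.2 ∈ K ∧ p.2 * p.1 ∈ K ∧ p.1 * p.2 ≠ p.2 * p.1)
    (hf : ProductOneFree (flat L + S)) : Good K (flat L + S) (k + 2 * L.card) := by
  induction L using Multiset.induction with
  | empty => simpa [flat] using h
  | cons p L ih =>
    rw [flat_cons] at hf ⊢
    rw [Multiset.cons_add, Multiset.cons_add] at hf ⊢
    have := ih (fun b hb => hL b (Multiset.mem_cons_of_mem hb))
      (free_of_le ((Multiset.le_cons_self _ _).trans (Multiset.le_cons_self _ _)) hf)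
    obtain ⟨a, b, c⟩ := hL p (by simp)
    exact (grow2 hK this a b c hf).mono (by simp; omega)

lemma grow_comm {K : Subgroup G} {S : Multiset G} {k : ℕ} (h : Good K S k) (r : ℕ) :
    ∀ (Q : Multiset G), Q.card = r → (∀ a ∈ Q, ∀ b ∈ Q, a * b ∈ K) →
    ProductOneFree (Q + S) → Good K (Q + S) (k + r / 2) := by
  induction r using Nat.strong_induction_on with
  | _ r ih =>
    intro Q hr hQ hf
    by_cases hr2 : r < 2
    · obtain ⟨X, a, b, c⟩ := h
      exact ⟨X, a, fun x hx => ⟨(b x hx).1, reach_mono (by simp) (b x hx).2⟩, by omega⟩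
    · obtain ⟨a, ha⟩ := Multiset.card_pos_iff_exists_mem.1 (show 0 < Q.card by omega)
      obtain ⟨Q1, rfl⟩ := Multiset.exists_cons_of_mem ha
      rw [Multiset.card_cons] at hr
      obtain ⟨b, hb⟩ := Multiset.card_pos_iff_exists_mem.1 (show 0 < Q1.card by omega)
      obtain ⟨Q2, rfl⟩ := Multiset.exists_cons_of_mem hb
      rw [Multiset.card_cons] at hr
      have e : (([a, b] : List G) : Multiset G) + (Q2 + S) = a ::ₘ b ::ₘ Q2 + S := by
        simp [← Multiset.cons_coe]
      have h1 := ih (r - 2) (by omega) Q2 (by omega)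
        (fun x hx y hy => hQ x (by simp [hx]) y (by simp [hy]))
        (free_of_le (by rw [← e]; simp) hf)
      have h2 := grow1 h1 (la := [a, b]) (by simp) (by simpa using hQ a (by simp) b (by simp))
        (by rw [e]; exact hf)
      rw [e] at h2
      exact h2.mono (by omega)

lemma decomp (r : ℕ) : ∀ (B : Multiset G), B.card = r → ∃ (L : Multiset (G × G)) (Q : Multiset G),
    B = flat L + Q ∧ (∀ p ∈ L, p.1 * p.2 ≠ p.2 * p.1) ∧ (∀ a ∈ Q, ∀ b ∈ Q, a * b = b * a) := by
  induction r using Nat.strong_induction_on with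
  | _ r ih =>
    intro B hr
    by_cases hB : ∀ a ∈ B, ∀ b ∈ B, a * b = b * a
    · exact ⟨0, B, by simp [flat], by simp, hB⟩
    · push Not at hB
      obtain ⟨a, ha, b, hb, hab⟩ := hB
      obtain ⟨B1, rfl⟩ := Multiset.exists_cons_of_mem ha
      have hb' : b ∈ B1 := by
        rcases Multiset.mem_cons.1 hb with rfl | h
        · exact absurd rfl hab
        · exact h
      obtain ⟨B2, rfl⟩ := Multiset.exists_cons_of_mem hb'
      simp only [Multiset.card_cons] at hr
      obtain ⟨L, Q, e, h1, h2⟩ := ih (r - 2) (by omega) B2 (by omega)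
      refine ⟨(a, b) ::ₘ L, Q, by rw [flat_cons, e]; simp, ?_, h2⟩
      intro p hp
      rcases Multiset.mem_cons.1 hp with rfl | hp
      · exact hab
      · exact h1 p hp

/-- first noncentral element doubles -/
lemma dbl {K H : Subgroup G} (hKH : K ≤ H) {S : Multiset G} {k : ℕ} (h : Good K S k) {a : G}
    (haH : a ∈ H) (haK : a ∉ K) : Good H (a ::ₘ S) (2 * k) := by
  classical
  obtain ⟨X, h1, hX, hk⟩ := h
  refine ⟨X ∪ X.image (· * a), by simp [h1], ?_, ?_⟩
  · intro x hx
    rw [Finset.mem_union, Finset.mem_image] at hx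
    rcases hx with hx | ⟨y, hy, rfl⟩
    · exact ⟨hKH (hX x hx).1, reach_mono (Multiset.le_cons_self _ _) (hX x hx).2⟩
    · exact ⟨H.mul_mem (hKH (hX y hy).1) haH, by simpa using reach_mul (la := [a]) (hX y hy).2⟩
  · rw [Finset.card_union_of_disjoint, Finset.card_image_of_injective _ (mul_left_injective a)]
    · omega
    · rw [Finset.disjoint_left]
      intro x hx hx'
      obtain ⟨y, hy, rfl⟩ := Finset.mem_image.1 hx'
      exact haK ((K.mul_mem_cancel_left (hX y hy).1).1 (hX _ hx).1)

lemma tpl {K H : Subgroup G} (hKH : K ≤ H) {S : Multiset G} {k : ℕ} (h : Good K S k) {p q : G}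
    (huH : p * q ∈ H) (hvH : q * p ∈ H) (huK : p * q ∉ K) (hvK : q * p ∉ K)
    (huv : (p * q) * (q * p)⁻¹ ∉ K) (hK : ∀ a ∈ H, ∀ b ∈ H, a * b = b * a) :
    Good H (p ::ₘ q ::ₘ S) (3 * k) := by
  classical
  obtain ⟨X, h1, hX, hk⟩ := h
  have E1 : (([p, q] : List G) : Multiset G) + S = p ::ₘ q ::ₘ S := by
    simp [← Multiset.cons_coe]
  have E2 : (([q, p] : List G) : Multiset G) + S = p ::ₘ q ::ₘ S := by
    simp [← Multiset.cons_coe]; exact Multiset.cons_swap _ _ _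
  refine ⟨(X ∪ X.image (· * (p * q))) ∪ X.image (· * (q * p)), by simp [h1], ?_, ?_⟩
  · intro x hx
    rw [Finset.mem_union, Finset.mem_union, Finset.mem_image, Finset.mem_image] at hx
    rcases hx with (hx | ⟨y, hy, rfl⟩) | ⟨y, hy, rfl⟩
    · exact ⟨hKH (hX x hx).1, reach_mono ((Multiset.le_cons_self _ _).trans (Multiset.le_cons_self _ _)) (hX x hx).2⟩
    · refine ⟨H.mul_mem (hKH (hX y hy).1) huH, ?_⟩
      have := reach_mul (la := [p, q]) (hX y hy).2
      rw [E1] at this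
      simpa using this
    · refine ⟨H.mul_mem (hKH (hX y hy).1) hvH, ?_⟩
      have := reach_mul (la := [q, p]) (hX y hy).2
      rw [E2] at this
      simpa using this
  · rw [Finset.card_union_of_disjoint, Finset.card_union_of_disjoint,
      Finset.card_image_of_injective _ (mul_left_injective _),
      Finset.card_image_of_injective _ (mul_left_injective _)]
    · omega
    · rw [Finset.disjoint_left]
      intro x hx hx'
      obtain ⟨y, hy, rfl⟩ := Finset.mem_image.1 hx'
      exact huK ((K.mul_mem_cancel_left (hX y hy).1).1 (hX _ hx).1)
    · rw [Finset.disjoint_left]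
      intro x hx hx'
      obtain ⟨y, hy, rfl⟩ := Finset.mem_image.1 hx'
      rcases Finset.mem_union.1 hx with hx | hx
      · exact hvK ((K.mul_mem_cancel_left (hX y hy).1).1 (hX _ hx).1)
      · obtain ⟨z, hz, hzz⟩ := Finset.mem_image.1 hx
        try simp only at hzz
        apply huv
        have : (p * q) * (q * p)⁻¹ = z⁻¹ * y := by
          rw [mul_inv_eq_iff_eq_mul, mul_assoc, ← hzz]; group
        rw [this]
        exact K.mul_mem (K.inv_mem (hX z hz).1) (hX y hy).1

lemma free_card_lt [Finite G] (C : Subgroup G) {S : Multiset G} (hS : ∀ a ∈ S, a ∈ C)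
    (hf : ProductOneFree S) : S.card < Nat.card C := by
  have := (grow_list (good_zero C) S hS (by simpa using hf)).le_card
  omega

theorem abstract_bound [Finite G] (H : Subgroup G) (N n : ℕ) (hn : Odd n)
    (hcard : Nat.card H = N) (hcomm : ∀ a ∈ H, ∀ b ∈ H, a * b = b * a)
    (hidx : ∀ a, a ∉ H → ∀ b, b ∉ H → a * b ∈ H)
    (hodd : ∀ a b : G, (a * b⁻¹ * a⁻¹ * b) ^ n = 1)
    (hcen : ∀ b, b ∉ H → Nat.card (Subgroup.centralizer {b}) ≤ N)
    (S : Multiset G) (hf : ProductOneFree S) : S.card ≤ N := by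
  classical
  have hcm : ∀ h ∈ H, ∀ b, b ∉ H → ∀ b', b' ∉ H → h * b = b * h → h * b' = b' * h := by
    intro h hh b hb b' hb' e
    have hm : b⁻¹ * b' ∈ H := hidx _ (by simpa using hb) _ hb'
    have := hcomm h hh _ hm
    calc h * b' = h * b * (b⁻¹ * b') := by group
      _ = b * (h * (b⁻¹ * b')) := by rw [e, mul_assoc]
      _ = b' * h := by rw [this]; group
  by_contra hlt
  push Not at hlt
  set A := S.filter (· ∈ H) with hA
  set B := S.filter (· ∉ H) with hB
  have hAB : A + B = S := Multiset.filter_add_not _ _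
  obtain ⟨L, Q, hBe, hL, hQ⟩ := decomp _ B rfl
  have hBm : ∀ b ∈ B, b ∉ H := fun b hb => (Multiset.mem_filter.1 hb).2
  have hAm : ∀ b ∈ A, b ∈ H := fun b hb => (Multiset.mem_filter.1 hb).2
  have hQm : ∀ b ∈ Q, b ∉ H := fun b hb => hBm b (by rw [hBe]; simp [hb])
  have hLm : ∀ p ∈ L, p.1 ∉ H ∧ p.2 ∉ H := by
    intro p hp
    constructor <;> apply hBm <;> rw [hBe, flat] <;> simp only [Multiset.mem_add]
    · exact Or.inl (Or.inl (Multiset.mem_map_of_mem _ hp))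
    · exact Or.inl (Or.inr (Multiset.mem_map_of_mem _ hp))
  have hL3 : ∀ p ∈ L, p.1 * p.2 ∈ H ∧ p.2 * p.1 ∈ H ∧ p.1 * p.2 ≠ p.2 * p.1 := fun p hp =>
    ⟨hidx _ (hLm p hp).1 _ (hLm p hp).2, hidx _ (hLm p hp).2 _ (hLm p hp).1, hL p hp⟩
  have hSe : S = A + (flat L + Q) := by rw [← hBe, hAB]
  have hcS : S.card = A.card + 2 * L.card + Q.card := by
    rw [hSe, Multiset.card_add, Multiset.card_add, card_flat]; omega
  rcases Multiset.empty_or_exists_mem Q with hQ0 | ⟨b0, hb0⟩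
  · subst hQ0
    rw [hSe] at hf
    have g1 := grow_pairs hcomm (good_zero H) L hL3 (free_of_le (by simp) hf)
    have g2 := (grow_list g1 A hAm hf).le_card
    simp at hcS
    omega
  · have hb0H := hQm b0 hb0
    set K := H ⊓ Subgroup.centralizer {b0} with hK
    have hKH : K ≤ H := inf_le_left
    have memK : ∀ {h}, h ∈ K ↔ h ∈ H ∧ h * b0 = b0 * h := by
      intro h
      rw [hK, Subgroup.mem_inf, Subgroup.mem_centralizer_singleton_iff]
    set A0 := A.filter (· ∈ K) with hA0
    set A1 := A.filter (· ∉ K) with hA1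
    have hA01 : A0 + A1 = A := Multiset.filter_add_not _ _
    have hcA : A.card = A0.card + A1.card := by rw [← hA01, Multiset.card_add]
    have hA1m : ∀ a ∈ A1, a ∈ H ∧ a ∉ K := fun a ha =>
      ⟨hAm a (Multiset.mem_filter.1 ha).1, (Multiset.mem_filter.1 ha).2⟩
    have hSe2 : S = A1 + (flat L + (A0 + Q)) := by
      rw [hSe, ← hA01]; abel
    have hf2 := hf
    rw [hSe2] at hf2
    have hfY : ProductOneFree (A0 + Q) := free_of_le ((Multiset.le_add_left _ _).trans (Multiset.le_add_left _ _)) hf2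
    have gQ := grow_comm (good_zero K) _ Q rfl (fun a ha b hb => memK.2 ⟨hidx a (hQm a ha) b (hQm b hb),
      by rw [mul_assoc, hQ b hb b0 hb0, ← mul_assoc, hQ a ha b0 hb0, mul_assoc]⟩)
      (by simpa using free_of_le (Multiset.le_add_left _ _) hfY)
    rw [add_zero] at gQ
    have gY := grow_list gQ A0 (fun a ha => (Multiset.mem_filter.1 ha).2) hfY
    rcases Multiset.empty_or_exists_mem A1 with hA10 | ⟨a, ha⟩
    · rcases Multiset.empty_or_exists_mem L with hL0 | ⟨p, hp⟩
      · have : ∀ g ∈ S, g ∈ Subgroup.centralizer {b0} := by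
          intro g hg
          rw [hSe2, hA10, hL0] at hg
          simp only [flat, Multiset.map_zero, add_zero, zero_add, Multiset.mem_add] at hg
          rw [Subgroup.mem_centralizer_singleton_iff]
          rcases hg with hg | hg
          · exact (memK.1 (Multiset.mem_filter.1 hg).2).2
          · exact hQ g hg b0 hb0
        have h1 := free_card_lt _ this hf
        have h2 := hcen b0 hb0H
        omega
      · obtain ⟨L', rfl⟩ := Multiset.exists_cons_of_mem hp
        obtain ⟨x1, x2, x3⟩ := hL3 p hp
        obtain ⟨y1, y2⟩ := hLm p hp
        obtain ⟨p, q⟩ := p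
        simp only at x1 x2 x3 y1 y2
        have k1 : p * q ∉ K := by
          intro hk
          have := hcm _ x1 b0 hb0H p y1 (memK.1 hk).2
          rw [mul_assoc] at this
          exact x3 (mul_left_cancel this).symm
        have k2 : q * p ∉ K := by
          intro hk
          have := hcm _ x2 b0 hb0H q y2 (memK.1 hk).2
          rw [mul_assoc] at this
          exact x3 (mul_left_cancel this)
        have k3 : (p * q) * (q * p)⁻¹ ∉ K := by
          intro hk
          set c := (p * q) * (q * p)⁻¹ with hc
          have hcp := hcm _ (memK.1 hk).1 b0 hb0H p y1 (memK.1 hk).2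
          have hpp := hcomm (p * q) x1 (p * p) (hidx p y1 p y1)
          have hinv : p⁻¹ * c * p = c⁻¹ := by
            have e1 : c = (p * q) * (p⁻¹ * (p * q) * p)⁻¹ := by rw [hc]; group
            have e2 : p⁻¹ * (p⁻¹ * (p * q) * p) * p = p * q := by
              calc _ = (p * p)⁻¹ * ((p * q) * (p * p)) := by group
                _ = p * q := by rw [hpp]; group
            calc p⁻¹ * c * p = (p⁻¹ * (p * q) * p) * (p⁻¹ * (p⁻¹ * (p * q) * p) * p)⁻¹ := by
                  rw [e1]; group
              _ = (p⁻¹ * (p * q) * p) * (p * q)⁻¹ := by rw [e2]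
              _ = c⁻¹ := by rw [e1]; group
          have hcc : c * c = 1 := by
            rw [mul_assoc, hcp, ← mul_assoc, inv_mul_cancel, one_mul] at hinv
            nth_rewrite 2 [hinv]
            exact mul_inv_cancel c
          have hcn : c ^ n = 1 := by
            rw [← hodd p q⁻¹, hc]; congr 1; group
          have : c = 1 := by
            obtain ⟨t, rfl⟩ := hn
            rw [pow_succ, pow_mul, pow_two, hcc, one_pow, one_mul] at hcn
            exact hcn
          rw [hc, mul_inv_eq_one] at this
          exact x3 this
        have g1 := tpl hKH gY x1 x2 k1 k2 k3 hcomm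
        rw [hSe2, flat_cons] at hf
        have e : A1 + (flat L' + (p ::ₘ q ::ₘ (A0 + Q))) = A1 + ((p ::ₘ q ::ₘ flat L') + (A0 + Q)) := by
          simp
        rw [← e] at hf
        have g2 := grow_pairs hcomm g1 L' (fun p hp => hL3 p (Multiset.mem_cons_of_mem hp))
          (free_of_le (by simp) hf)
        have g3 := (grow_list g2 A1 (fun a ha => (hA1m a ha).1) hf).le_card
        simp only [Multiset.card_cons] at hcS
        omega
    · obtain ⟨h1, h2⟩ := hA1m a ha
      have g1 := dbl hKH gY h1 h2
      obtain ⟨A2, hA2⟩ := Multiset.exists_cons_of_mem ha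
      rw [hSe2, hA2] at hf
      have e : A2 + (flat L + (a ::ₘ (A0 + Q))) = a ::ₘ A2 + (flat L + (A0 + Q)) := by simp
      rw [← e] at hf
      have g2 := grow_pairs hcomm g1 L hL3 (free_of_le (by simp) hf)
      have g3 := (grow_list g2 A2 (fun b hb => (hA1m b (by rw [hA2]; simp [hb])).1) hf).le_card
      have : A1.card = A2.card + 1 := by rw [hA2]; simp
      omega

end Abstract

section Concrete
variable {m n : ℕ} {s : ℤ}

lemma mc_xm : mcX m n s ^ m = 1 := by
  have : PresentedGroup.mk (metacyclicRels m n s) (FreeGroup.of 0 ^ m) = 1 :=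
    PresentedGroup.one_of_mem (by simp [metacyclicRels])
  rw [map_pow] at this
  exact this

lemma mc_yn : mcY m n s ^ n = 1 := by
  have : PresentedGroup.mk (metacyclicRels m n s) (FreeGroup.of 1 ^ n) = 1 :=
    PresentedGroup.one_of_mem (by simp [metacyclicRels])
  rw [map_pow] at this
  exact this

lemma mc_yx : mcY m n s * mcX m n s = mcX m n s * mcY m n s ^ s := by
  have : PresentedGroup.mk (metacyclicRels m n s)
      (FreeGroup.of 1 * FreeGroup.of 0 * (FreeGroup.of 0 * FreeGroup.of 1 ^ s)⁻¹) = 1 :=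
    PresentedGroup.one_of_mem (by simp [metacyclicRels])
  rw [map_mul, map_inv, mul_inv_eq_one, map_mul, map_mul, map_zpow] at this
  exact this

/-- homs out of the group -/
def mcLift {K : Type*} [Group K] (a b : K) (h1 : a ^ m = 1) (h2 : b ^ n = 1)
    (h3 : b * a = a * b ^ s) : Metacyclic m n s →* K :=
  PresentedGroup.toGroup (f := ![a, b]) (by
    intro r hr
    simp only [metacyclicRels, Set.mem_insert_iff, Set.mem_singleton_iff] at hr
    rcases hr with rfl | rfl | rfl
    · simpa using h1
    · simpa using h2
    · simp only [map_mul, map_inv, map_zpow, FreeGroup.lift_apply_of]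
      rw [mul_inv_eq_one]
      simpa using h3)

lemma mcLift_x {K : Type*} [Group K] (a b : K) (h1 : a ^ m = 1) (h2 : b ^ n = 1)
    (h3 : b * a = a * b ^ s) : mcLift a b h1 h2 h3 (mcX m n s) = a := by
  simp [mcLift, mcX]

lemma mcLift_y {K : Type*} [Group K] (a b : K) (h1 : a ^ m = 1) (h2 : b ^ n = 1)
    (h3 : b * a = a * b ^ s) : mcLift a b h1 h2 h3 (mcY m n s) = b := by
  simp [mcLift, mcY]

lemma mc_yzx (k : ℤ) : mcY m n s ^ k * mcX m n s = mcX m n s * mcY m n s ^ (s * k) := by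
  have h : (mcX m n s)⁻¹ * mcY m n s * mcX m n s = mcY m n s ^ s := by
    rw [mul_assoc, mc_yx]; group
  have h2 : (mcX m n s)⁻¹ * mcY m n s ^ k * mcX m n s = mcY m n s ^ (s * k) := by
    rw [zpow_mul, ← h]
    have := conj_zpow (i := k) (a := (mcX m n s)⁻¹) (b := mcY m n s)
    rw [inv_inv] at this
    exact this.symm
  rw [← h2]; group

lemma mc_yzxp (k : ℤ) (i : ℕ) :
    mcY m n s ^ k * mcX m n s ^ i = mcX m n s ^ i * mcY m n s ^ (s ^ i * k) := by
  induction i generalizing k with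
  | zero => simp
  | succ i ih =>
    rw [pow_succ (mcX m n s), ← mul_assoc, ih, mul_assoc, mc_yzx, ← mul_assoc]
    congr 2; ring

lemma mc_mul (i i' : ℕ) (j j' : ℤ) :
    (mcX m n s ^ i * mcY m n s ^ j) * (mcX m n s ^ i' * mcY m n s ^ j') =
      mcX m n s ^ (i + i') * mcY m n s ^ (s ^ i' * j + j') := by
  rw [mul_assoc, ← mul_assoc (mcY m n s ^ j), mc_yzxp, pow_add, zpow_add]
  group

lemma mc_form (hm : 0 < m) (g : Metacyclic m n s) :
    ∃ (i : ℕ) (j : ℤ), g = mcX m n s ^ i * mcY m n s ^ j := by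
  have hcl : g ∈ Subgroup.closure (Set.range (PresentedGroup.of (rels := metacyclicRels m n s))) := by
    rw [PresentedGroup.closure_range_of]; trivial
  have hx : (mcX m n s)⁻¹ = mcX m n s ^ (m - 1) := by
    rw [inv_eq_iff_mul_eq_one, ← pow_succ', Nat.sub_add_cancel hm, mc_xm]
  induction hcl using Subgroup.closure_induction with
  | mem x hx =>
    obtain ⟨i, rfl⟩ := hx
    fin_cases i
    · exact ⟨1, 0, by simp [mcX]⟩
    · exact ⟨0, 1, by simp [mcY]⟩
  | one => exact ⟨0, 0, by simp⟩
  | mul x y _ _ hx hy =>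
    obtain ⟨i, j, rfl⟩ := hx
    obtain ⟨i', j', rfl⟩ := hy
    exact ⟨_, _, mc_mul _ _ _ _⟩
  | inv x _ h =>
    obtain ⟨i, j, rfl⟩ := h
    refine ⟨(m - 1) * i, s ^ ((m - 1) * i) * (-j), ?_⟩
    rw [← mc_yzxp, mul_inv_rev, zpow_neg, ← inv_pow, hx, pow_mul]

lemma mc_y_congr {j j' : ℤ} (h : (j : ZMod n) = j') : mcY m n s ^ j = mcY m n s ^ j' := by
  rw [ZMod.intCast_eq_intCast_iff] at h
  rw [zpow_eq_zpow_iff_modEq]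
  exact h.of_dvd (Int.natCast_dvd_natCast.2 (orderOf_dvd_of_pow_eq_one mc_yn))

/-- projection to `C_m` -/
def mcPi (m n : ℕ) (s : ℤ) : Metacyclic m n s →* Multiplicative (ZMod m) :=
  mcLift (Multiplicative.ofAdd 1) 1 (by rw [← ofAdd_nsmul]; simp) (by simp) (by simp)

lemma mcPi_apply (i : ℕ) (j : ℤ) :
    mcPi m n s (mcX m n s ^ i * mcY m n s ^ j) = Multiplicative.ofAdd (i : ZMod m) := by
  rw [map_mul, map_pow, map_zpow, mcPi, mcLift_x, mcLift_y, ← ofAdd_nsmul]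
  simp

/-- sign -/
def mcSgn (n : ℕ) (s : ℤ) (hme : Even m) : Metacyclic m n s →* ℤˣ :=
  mcLift (-1) 1 (hme.neg_one_pow) (by simp) (by simp)

lemma mcSgn_apply (hme : Even m) (i : ℕ) (j : ℤ) :
    mcSgn n s hme (mcX m n s ^ i * mcY m n s ^ j) = (-1) ^ i := by
  rw [map_mul, map_pow, map_zpow, mcSgn, mcLift_x, mcLift_y]
  simp

/-- scaling by `s` -/
def scal (n : ℕ) (s : ℤ) (hs : (s : ZMod n) * s = 1) : Equiv.Perm (ZMod n) where
  toFun j := s * j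
  invFun j := s * j
  left_inv j := by
    change (s : ZMod n) * (s * j) = j
    rw [← mul_assoc, hs, one_mul]
  right_inv j := by
    change (s : ZMod n) * (s * j) = j
    rw [← mul_assoc, hs, one_mul]

lemma mc_y_inj (hme : Even m) (hs : (s : ZMod n) * s = 1) {j j' : ℤ}
    (h : mcY m n s ^ j = mcY m n s ^ j') : (j : ZMod n) = j' := by
  have hb : ∀ k : ℤ, (Equiv.addRight (1 : ZMod n)) ^ k = Equiv.addRight (k : ZMod n) := by
    have h0 : ∀ k : ℕ, (Equiv.addRight (1 : ZMod n)) ^ k = Equiv.addRight (k : ZMod n) := by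
      intro k
      induction k with
      | zero => ext1 j; simp
      | succ k ih => ext1 j; rw [pow_succ', ih]; simp [add_assoc]
    intro k
    obtain ⟨k, rfl | rfl⟩ := k.eq_nat_or_neg
    · rw [zpow_natCast, h0]; simp
    · rw [zpow_neg, zpow_natCast, h0, inv_eq_iff_mul_eq_one]; ext1 j; simp
  let f : Metacyclic m n s →* Equiv.Perm (ZMod n) := mcLift (scal n s hs) (Equiv.addRight 1)
    (by
      obtain ⟨t, rfl⟩ := hme
      have : scal n s hs ^ 2 = 1 := by
        ext1 j
        simp only [pow_two, Equiv.Perm.mul_apply, Equiv.Perm.one_apply]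
        exact (scal n s hs).left_inv j
      rw [← two_mul, pow_mul, this, one_pow])
    (by
      have := hb n
      rw [zpow_natCast] at this
      rw [this]; ext1 j; simp)
    (by
      rw [hb]; ext1 j
      simp [scal, mul_add, hs])
  have h2 := congrArg f h
  rw [map_zpow, map_zpow, mcLift_y, hb, hb] at h2
  have h3 := congrArg (fun e : Equiv.Perm (ZMod n) => e 0) h2
  simpa using h3

lemma mc_card (hm : 0 < m) (hn : 0 < n) (hme : Even m) (hs : (s : ZMod n) * s = 1) :
    Finite (Metacyclic m n s) ∧ Nat.card (Metacyclic m n s) = m * n := by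
  let f : Fin m × Fin n → Metacyclic m n s := fun p => mcX m n s ^ (p.1 : ℕ) * mcY m n s ^ ((p.2 : ℕ) : ℤ)
  have hf : Function.Bijective f := by
    constructor
    · rintro ⟨i, j⟩ ⟨i', j'⟩ h
      simp only [f] at h
      have h1 := congrArg (mcPi m n s) h
      rw [mcPi_apply, mcPi_apply] at h1
      have h1' : ((i : ℕ) : ZMod m) = ((i' : ℕ) : ZMod m) := Multiplicative.ofAdd.injective h1
      rw [ZMod.natCast_eq_natCast_iff] at h1'
      have e : (i : ℕ) = i' := Nat.ModEq.eq_of_lt_of_lt h1' i.2 i'.2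
      rw [e] at h
      have h2 := mc_y_inj hme hs (mul_left_cancel h)
      rw [Int.cast_natCast, Int.cast_natCast, ZMod.natCast_eq_natCast_iff] at h2
      have e2 : (j : ℕ) = j' := Nat.ModEq.eq_of_lt_of_lt h2 j.2 j'.2
      exact Prod.ext (Fin.ext e) (Fin.ext e2)
    · intro g
      obtain ⟨i, j, rfl⟩ := mc_form hm g
      have hj0 : 0 ≤ j % n := Int.emod_nonneg _ (by omega)
      have hj1 : j % n < n := Int.emod_lt_of_pos _ (by omega)
      refine ⟨(⟨i % m, Nat.mod_lt _ hm⟩, ⟨(j % n).toNat, by omega⟩), ?_⟩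
      simp only [f]
      congr 1
      · exact (pow_eq_pow_mod i mc_xm).symm
      · apply mc_y_congr
        rw [Int.toNat_of_nonneg hj0]
        simp
  have e := Equiv.ofBijective f hf
  exact ⟨Finite.of_equiv _ e, by rw [← Nat.card_congr e]; simp⟩

lemma mc_ord_y (hn : 0 < n) (hme : Even m) (hs : (s : ZMod n) * s = 1) :
    orderOf (mcY m n s) = n := by
  apply Nat.dvd_antisymm (orderOf_dvd_of_pow_eq_one mc_yn)
  have h := pow_orderOf_eq_one (mcY m n s)
  have h2 := mc_y_inj (j := orderOf (mcY m n s)) (j' := 0) hme hs (by simpa using h)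
  rw [Int.cast_natCast, Int.cast_zero, ZMod.natCast_eq_zero_iff] at h2
  exact h2

lemma mc_ord_x : orderOf (mcX m n s) = m := by
  apply Nat.dvd_antisymm (orderOf_dvd_of_pow_eq_one mc_xm)
  have h := pow_orderOf_eq_one (mcX m n s)
  have h2 := mcPi_apply (m := m) (n := n) (s := s) (orderOf (mcX m n s)) 0
  rw [h, zpow_zero, mul_one, map_one] at h2
  have h3 : ((orderOf (mcX m n s) : ℕ) : ZMod m) = 0 := Multiplicative.ofAdd.injective h2.symm
  rwa [ZMod.natCast_eq_zero_iff] at h3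

lemma mc_ev {i : ℕ} (hi : Even i) (hs : (s : ZMod n) * s = 1) : ((s ^ i : ℤ) : ZMod n) = 1 := by
  obtain ⟨t, rfl⟩ := hi
  push_cast
  rw [← two_mul, pow_mul, pow_two, hs, one_pow]

lemma mc_mem (hme : Even m) (i : ℕ) (j : ℤ) :
    mcX m n s ^ i * mcY m n s ^ j ∈ (mcSgn n s hme).ker ↔ Even i := by
  rw [MonoidHom.mem_ker, mcSgn_apply]
  rcases Nat.even_or_odd i with h | h
  · simp [h]
  · rw [h.neg_one_pow]
    simpa using h

lemma mc_upper (hm : 0 < m) (hme : Even m) (hn : 0 < n) (hno : Odd n)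
    (hs : (s : ZMod n) * s = 1) (hs1 : (s : ZMod n) ≠ 1)
    (S : Multiset (Metacyclic m n s)) (hf : ProductOneFree S) : S.card ≤ m * n / 2 := by
  obtain ⟨hfin, hc⟩ := mc_card (s := s) hm hn hme hs
  have hidx : (mcSgn n s hme).ker.index = 2 := by
    rw [Subgroup.index_ker]
    have : (mcSgn n s hme).range = ⊤ := by
      rw [MonoidHom.range_eq_top]
      intro u
      rcases Int.units_eq_one_or u with rfl | rfl
      · exact ⟨1, map_one _⟩
      · exact ⟨mcX m n s, by rw [mcSgn, mcLift_x]⟩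
    rw [this]
    simp
  have hck := (mcSgn n s hme).ker.card_mul_index
  rw [hidx, hc] at hck
  refine abstract_bound (mcSgn n s hme).ker (m * n / 2) n hno (by omega) ?_ ?_ ?_ ?_ S hf
  · intro a ha b hb
    obtain ⟨i, j, rfl⟩ := mc_form hm a
    obtain ⟨i', j', rfl⟩ := mc_form hm b
    rw [mc_mem] at ha hb
    rw [mc_mul, mc_mul, add_comm i i']
    congr 1
    apply mc_y_congr
    rw [Int.cast_add, Int.cast_add, Int.cast_mul, Int.cast_mul, mc_ev ha hs, mc_ev hb hs]
    ring
  · intro a ha b hb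
    exact (Subgroup.mul_mem_iff_of_index_two hidx).2 (by simp [ha, hb])
  · intro a b
    have h1 : mcPi m n s (a * b⁻¹ * a⁻¹ * b) = 1 := by
      simp only [map_mul, map_inv]
      rw [mul_right_comm (mcPi m n s a)]
      simp
    generalize a * b⁻¹ * a⁻¹ * b = c at h1 ⊢
    obtain ⟨i, j, rfl⟩ := mc_form hm c
    rw [mcPi_apply] at h1
    have h3 : ((i : ℕ) : ZMod m) = 0 := Multiplicative.ofAdd.injective h1
    rw [ZMod.natCast_eq_zero_iff] at h3
    obtain ⟨t, rfl⟩ := h3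
    rw [pow_mul, mc_xm, one_pow, one_mul, ← zpow_natCast, ← zpow_mul, mul_comm, zpow_mul, zpow_natCast,
      mc_yn, one_zpow]
  · intro b hb
    have hne : Subgroup.centralizer {b} ≠ ⊤ := by
      intro htop
      have hy : mcY m n s ∈ Subgroup.centralizer {b} := by rw [htop]; trivial
      rw [Subgroup.mem_centralizer_singleton_iff] at hy
      obtain ⟨i, j, rfl⟩ := mc_form hm b
      rw [mc_mem, Nat.not_even_iff_odd] at hb
      have e1 := mc_mul (m := m) (n := n) (s := s) 0 i 1 j
      have e2 := mc_mul (m := m) (n := n) (s := s) i 0 j 1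
      simp only [pow_zero, one_mul, zpow_one, zero_add, add_zero, mul_one] at e1 e2
      rw [e1, e2] at hy
      have := mc_y_inj hme hs (mul_left_cancel hy)
      obtain ⟨t, rfl⟩ := hb
      rw [pow_succ] at this
      push_cast at this
      rw [pow_mul, pow_two, hs, one_pow, one_mul, add_comm] at this
      exact hs1 (add_left_cancel this)
    have h1 := (Subgroup.centralizer {b}).card_mul_index
    have h2 : (Subgroup.centralizer {b}).index ≠ 1 := by rwa [Ne, Subgroup.index_eq_one]
    have h3 : (Subgroup.centralizer {b}).index ≠ 0 := Subgroup.index_ne_zero_of_finite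
    rw [hc] at h1
    rw [Nat.le_div_iff_mul_le (by norm_num), ← h1]
    exact Nat.mul_le_mul_left _ (by omega)

lemma mc_lower (hm : 0 < m) (hme : Even m) (hn : 0 < n)
    (hs : (s : ZMod n) * s = 1) (hgcd : Nat.gcd (m / 2) n = 1) :
    ∃ S : Multiset (Metacyclic m n s), S.card = m * n / 2 ∧ ProductOneFree S := by
  classical
  set h := mcX m n s ^ 2 * mcY m n s with hh
  have hm2 : 2 ∣ m := hme.two_dvd
  have hN : m / 2 * n = m * n / 2 := Nat.div_mul_right_comm hm2 n
  have hNpos : 0 < m * n / 2 := by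
    rw [← hN]; exact Nat.mul_pos (by omega) hn
  have hox : orderOf (mcX m n s ^ 2) = m / 2 := by
    rw [orderOf_pow_of_dvd (by norm_num) (by rw [mc_ord_x]; exact hm2), mc_ord_x]
  have hcom : Commute (mcX m n s ^ 2) (mcY m n s) := by
    have e := mc_yzxp (m := m) (n := n) (s := s) 1 2
    rw [zpow_one] at e
    have e2 : mcY m n s ^ (s ^ 2 * 1) = mcY m n s ^ (1 : ℤ) := mc_y_congr (by
      rw [mul_one, mc_ev (by decide) hs]; simp)
    rw [e2, zpow_one] at e
    exact e.symm
  have hoh : orderOf h = m * n / 2 := by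
    rw [hh, hcom.orderOf_mul_eq_mul_orderOf_of_coprime, hox, mc_ord_y hn hme hs, hN]
    rw [hox, mc_ord_y hn hme hs]; exact hgcd
  have sh : mcSgn n s hme h = 1 := by
    have := mcSgn_apply (n := n) (s := s) hme 2 1
    rw [zpow_one] at this
    rw [hh, this]; simp
  have sx : mcSgn n s hme (mcX m n s) = -1 := by rw [mcSgn, mcLift_x]
  refine ⟨mcX m n s ::ₘ Multiset.replicate (m * n / 2 - 1) h, by simp; omega, ?_⟩
  rintro T hT hT0 ⟨l, rfl, hl⟩
  by_cases hx : mcX m n s ∈ (l : Multiset (Metacyclic m n s))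
  · obtain ⟨T', hT'⟩ := Multiset.exists_cons_of_mem hx
    rw [hT', Multiset.cons_le_cons_iff, Multiset.le_replicate_iff] at hT
    obtain ⟨w, _, hT⟩ := hT
    have h1 := congrArg (mcSgn n s hme) hl
    rw [map_one, map_list_prod] at h1
    have h2 : ((l : Multiset (Metacyclic m n s)).map (mcSgn n s hme)).prod = 1 := by
      rw [Multiset.map_coe, Multiset.prod_coe]; exact h1
    rw [hT', Multiset.map_cons, Multiset.prod_cons, hT, Multiset.map_replicate, sh, sx] at h2
    simp at h2
  · have hle := (Multiset.le_cons_of_notMem hx).1 hT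
    rw [Multiset.le_replicate_iff] at hle
    obtain ⟨w, h1, h2⟩ := hle
    have hw : l.length = w := by rw [← Multiset.coe_card, h2, Multiset.card_replicate]
    subst hw
    have hl2 : l = List.replicate l.length h := by
      rw [← Multiset.coe_replicate, Multiset.coe_eq_coe] at h2
      exact List.perm_replicate.1 h2
    rw [hl2, List.prod_replicate] at hl
    have := orderOf_dvd_of_pow_eq_one hl
    rw [hoh] at this
    have hpos : 0 < l.length := by
      rw [← Multiset.coe_card]; exact Multiset.card_pos.2 hT0
    have := Nat.le_of_dvd hpos this
    omega

end Concrete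

lemma filter_prod {G : Type*} [Group G] [DecidableEq G] (l : List G) :
    (l.filter (· ≠ 1)).prod = l.prod := by
  induction l with
  | nil => rfl
  | cons a l ih =>
    by_cases ha : a = 1
    · rw [List.filter_cons_of_neg (by simpa using ha), ih, ha, List.prod_cons, one_mul]
    · rw [List.filter_cons_of_pos (by simpa using ha), List.prod_cons, List.prod_cons, ih]

lemma gao_lower {G : Type*} [Group G] [Finite G] (S : Multiset G) (hf : ProductOneFree S) :
    S.card + Nat.card G ≤ gaoConstant G := by
  classical
  have := Fintype.ofFinite G
  have hpos : 0 < Nat.card G := Nat.card_pos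
  apply le_csInf
  · refine ⟨Nat.card G * Nat.card G + 1, by omega, ?_⟩
    intro T hT
    have : ∃ g, Nat.card G ≤ T.count g := by
      by_contra hcon
      push Not at hcon
      have h1 : T.card = ∑ g : G, T.count g := by
        rw [← Multiset.sum_count_eq_card (s := Finset.univ) (by simp)]
      have h2 : ∑ g : G, T.count g ≤ ∑ g : G, Nat.card G := Finset.sum_le_sum fun g _ => (hcon g).le
      rw [Finset.sum_const, Finset.card_univ, ← Nat.card_eq_fintype_card, smul_eq_mul] at h2
      omega
    obtain ⟨g, hg⟩ := this
    exact ⟨Multiset.replicate (Nat.card G) g, Multiset.le_count_iff_replicate_le.1 hg, by simp,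
      List.replicate (Nat.card G) g, Multiset.coe_replicate _ _, by simp⟩
  · rintro ℓ ⟨_, hℓ⟩
    by_contra hlt
    obtain ⟨T, hT, hTc, l, rfl, hl⟩ := hℓ (S + Multiset.replicate (Nat.card G - 1) 1) 
      (by rw [Multiset.card_add, Multiset.card_replicate]; omega)
    have h1S : (1 : G) ∉ S := fun h => hf {1} (by simpa using h) (by simp) ⟨[1], by simp, by simp⟩
    have hle : (l : Multiset G).filter (· ≠ 1) ≤ S := by
      refine (Multiset.filter_le_filter _ hT).trans ?_
      rw [Multiset.filter_add]
      have : (Multiset.replicate (Nat.card G - 1) (1 : G)).filter (· ≠ 1) = 0 := by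
        rw [Multiset.filter_eq_nil]
        intro a ha
        simp [Multiset.eq_of_mem_replicate ha]
      rw [this, add_zero]
      exact Multiset.filter_le _ _
    refine hf _ hle ?_ ⟨l.filter (· ≠ 1), by simp, ?_⟩
    · intro h0
      rw [Multiset.filter_eq_nil] at h0
      have hrep : (l : Multiset G) = Multiset.replicate (Nat.card G) 1 :=
        Multiset.eq_replicate.2 ⟨hTc, fun b hb => by simpa using h0 b hb⟩
      rw [hrep, ← Multiset.le_count_iff_replicate_le, Multiset.count_add,
        Multiset.count_eq_zero_of_notMem h1S, Multiset.count_replicate_self] at hT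
      omega
    · exact (filter_prod l).trans hl

/-- Let `m ≥ 4` be even, `n ≥ 3` odd, `ord_n(s) = 2`.  If `gcd(m/2, n) = 1`, then
`d(G_{m,n,s}) = mn/2` and `E(G_{m,n,s}) ≥ 3mn/2`; in particular `G_{m,n,s}` does not
satisfy the conclusion of Bass' conjecture. -/
theorem bass_fails_of_coprime (m n : ℕ) (s : ℤ) (hm : 4 ≤ m) (hme : Even m)
    (hn : 3 ≤ n) (hno : Odd n) (hord : orderOf (s : ZMod n) = 2)
    (hgcd : Nat.gcd (m / 2) n = 1) :
    smallDavenport (Metacyclic m n s) = m * n / 2 ∧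
    3 * (m * n) / 2 ≤ gaoConstant (Metacyclic m n s) ∧
    ¬ (smallDavenport (Metacyclic m n s) = m + n - 2 ∧
       gaoConstant (Metacyclic m n s) = m * n + m + n - 2) := by
  have hs : (s : ZMod n) * s = 1 := by
    rw [← pow_two, ← hord]; exact pow_orderOf_eq_one _
  have hs1 : (s : ZMod n) ≠ 1 := by
    intro h
    rw [h, orderOf_one] at hord
    omega
  obtain ⟨hfin, hc⟩ := mc_card (s := s) (by omega : 0 < m) (by omega : 0 < n) hme hs
  obtain ⟨S, hS, hf⟩ := mc_lower (s := s) (by omega : 0 < m) hme (by omega : 0 < n) hs hgcd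
  have hd : smallDavenport (Metacyclic m n s) = m * n / 2 := by
    apply IsGreatest.csSup_eq
    refine ⟨⟨S, hS, hf⟩, ?_⟩
    rintro k ⟨T, rfl, hT⟩
    exact mc_upper (by omega) hme (by omega) hno hs hs1 T hT
  refine ⟨hd, ?_, ?_⟩
  · have := gao_lower S hf
    rw [hS, hc] at this
    have h2 : 2 ∣ m * n := hme.two_dvd.mul_right n
    omega
  · rintro ⟨h, -⟩
    rw [hd] at h
    obtain ⟨t, rfl⟩ := hme
    have e : (t + t) * n / 2 = t * n := by
      rw [← two_mul, mul_assoc, Nat.mul_div_cancel_left _ (by norm_num)]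
    rw [e] at h
    obtain ⟨a, rfl⟩ := Nat.exists_eq_add_of_le hn
    obtain ⟨b, rfl⟩ := Nat.exists_eq_add_of_le (show 2 ≤ t by omega)
    have : (2 + b) * (3 + a) = 6 + 3 * b + 2 * a + b * a := by ring
    rw [this] at h
    have := Nat.zero_le (b * a)
    omega
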